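/- There is a 5-clause Achlioptas rule for random 3-SAT (namely: select the first among the first 4 presented clauses that contains at least two positive literals, and otherwise select the 5th clause) such that the formula Φ_m generated after m = ⌊5.06·n⌋ steps is satisfiable with probability tending to 1 as n → ∞. -/

import Mathlib

open Finset Filter

/-- A literal over `n` variables: a variable together with a sign (`true` = positive). -/
abbrev Lit (n : ℕ) := Fin n × Bool

/-- A `k`-clause over `n` variables: a set of `k` literals on `k` distinct variables.
There are `C(n,k) * 2^k` such clauses. -/
abbrev Clause (n k : ℕ) :=
  {C : Finset (Lit n) // C.card = k ∧ (C.image Prod.fst).card = k}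

/-- The number of positive literals in a clause. -/
def Clause.posCount {n k : ℕ} (C : Clause n k) : ℕ :=
  (C.1.filter fun p => p.2 = true).card

/-- The assignment `σ` satisfies the clause `C`. -/
def Sat {n k : ℕ} (σ : Fin n → Bool) (C : Clause n k) : Prop :=
  ∃ p ∈ C.1, σ p.1 = p.2

/-- A formula (a finite sequence of clauses) is satisfiable. -/
def Satisfiable {n k m : ℕ} (Φ : Fin m → Clause n k) : Prop :=
  ∃ σ : Fin n → Bool, ∀ i, Sat σ (Φ i)

/-- The Achlioptas rule: select the first among the first `l - 1` presented clauses
containing at least two positive literals; if there is none, select the `l`-th clause. -/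
def select {n k l : ℕ} (hl : 0 < l) (cs : Fin l → Clause n k) : Clause n k :=
  match (List.finRange l).find? (fun i => decide (i.1 + 1 < l ∧ 2 ≤ (cs i).posCount)) with
  | some i => cs i
  | none => cs ⟨l - 1, Nat.sub_lt hl one_pos⟩

/-- The probability of the event `P` under the uniform distribution on the finite type `α`;
in particular, for `α = Fin m → Fin l → Clause n k` this is the probability that `P` holds
for `m` rounds of `l` clauses drawn independently and uniformly at random with replacement. -/
noncomputable def unifProb {α : Type*} [Fintype α] (P : α → Prop) : ℝ :=
  (Nat.card {a // P a} : ℝ) / (Fintype.card α : ℝ)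

def lneg {n : ℕ} (a : Lit n) : Lit n := (a.1, !a.2)

lemma lneg_lneg {n : ℕ} (a : Lit n) : lneg (lneg a) = a := by
  simp [lneg]

lemma lneg_ne {n : ℕ} (a : Lit n) : lneg a ≠ a := by
  intro h
  have := congrArg Prod.snd h
  simp [lneg] at this

lemma lit_cases {n : ℕ} {a b : Lit n} (h : a.1 = b.1) : a = b ∨ a = lneg b := by
  obtain ⟨a1, a2⟩ := a
  obtain ⟨b1, b2⟩ := b
  simp only at h
  subst h
  cases a2 <;> cases b2 <;> simp [lneg]

def REdge {n m : ℕ} (ξ : Fin m → Finset (Lit n)) (a b : Lit n) : Prop :=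
  ∃ k, ξ k = {lneg a, b}

lemma REdge.symm' {n m : ℕ} {ξ : Fin m → Finset (Lit n)} {a b : Lit n} (h : REdge ξ a b) :
    REdge ξ (lneg b) (lneg a) := by
  obtain ⟨k, hk⟩ := h
  exact ⟨k, by rw [hk, lneg_lneg, Finset.pair_comm]⟩

def SatF {n m : ℕ} (ξ : Fin m → Finset (Lit n)) : Prop :=
  ∃ σ : Fin n → Bool, ∀ i, ∃ p ∈ ξ i, σ p.1 = p.2

abbrev Reach {n m : ℕ} (ξ : Fin m → Finset (Lit n)) := Relation.ReflTransGen (REdge ξ)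

lemma reach_symm {n m : ℕ} {ξ : Fin m → Finset (Lit n)} {a b : Lit n} (h : Reach ξ a b) :
    Reach ξ (lneg b) (lneg a) := by
  induction h with
  | refl => exact .refl
  | tail _ h2 ih => exact .head h2.symm' ih

lemma twosat {n m : ℕ} (ξ : Fin m → Finset (Lit n)) (h2 : ∀ i, (ξ i).card = 2)
    (hno : ∀ x, Reach ξ x (lneg x) → ¬ Reach ξ (lneg x) x) : SatF ξ := by
  classical
  let Q : Finset (Finset (Lit n)) := Finset.univ.filter (fun S =>
    (∀ a ∈ S, ∀ b, REdge ξ a b → b ∈ S) ∧ (∀ a ∈ S, lneg a ∉ S))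
  have hQ : Q.Nonempty := ⟨∅, by simp [Q]⟩
  obtain ⟨S, hS, hmax⟩ := Q.exists_max_image Finset.card hQ
  simp only [Q, Finset.mem_filter, Finset.mem_univ, true_and] at hS hmax
  obtain ⟨hcl, hcons⟩ := hS
  have hclR : ∀ a ∈ S, ∀ b, Reach ξ a b → b ∈ S := by
    intro a ha b hab
    induction hab with
    | refl => exact ha
    | tail _ h2 ih => exact hcl _ ih _ h2
  have key : ∀ y : Lit n, y ∉ S → lneg y ∉ S → ¬ Reach ξ y (lneg y) → False := by
    intro y hy hny hr
    have := hmax (S ∪ Finset.univ.filter (fun z => Reach ξ y z)) ⟨?_, ?_⟩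
    · have hlt : S ⊂ (S ∪ Finset.univ.filter (fun z => Reach ξ y z)) := by
        refine Finset.ssubset_iff_subset_ne.2 ⟨Finset.subset_union_left, fun he => hy ?_⟩
        rw [he]
        simp only [Finset.mem_union, Finset.mem_filter, Finset.mem_univ, true_and]
        exact Or.inr .refl
      have := Finset.card_lt_card hlt
      omega
    · intro a ha b hab
      simp only [Finset.mem_union, Finset.mem_filter, Finset.mem_univ, true_and] at ha ⊢
      rcases ha with ha | ha
      · exact Or.inl (hcl _ ha _ hab)
      · exact Or.inr (ha.tail hab)
    · intro a ha hna
      simp only [Finset.mem_union, Finset.mem_filter, Finset.mem_univ, true_and] at ha hna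
      rcases ha with ha | ha <;> rcases hna with hna | hna
      · exact hcons _ ha hna
      · have := reach_symm hna
        rw [lneg_lneg] at this
        exact hny (hclR _ ha _ this)
      · exact hny (hclR _ hna _ (reach_symm ha))
      · have := reach_symm hna
        rw [lneg_lneg] at this
        exact hr (ha.trans this)
  have hcomp : ∀ y : Lit n, y ∈ S ∨ lneg y ∈ S := by
    intro y
    by_contra hc
    push Not at hc
    by_cases hr : Reach ξ y (lneg y)
    · refine key (lneg y) hc.2 (by rw [lneg_lneg]; exact hc.1) ?_
      rw [lneg_lneg]
      exact hno y hr
    · exact key y hc.1 hc.2 hr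
  have hσ : ∀ a ∈ S, decide ((a.1, true) ∈ S) = a.2 := by
    intro a ha
    obtain ⟨v, b⟩ := a
    cases b
    · have := hcons _ ha
      simpa [lneg] using this
    · simpa using ha
  refine ⟨fun v => decide ((v, true) ∈ S), fun i => ?_⟩
  obtain ⟨a, b, hab, hi⟩ := Finset.card_eq_two.1 (h2 i)
  rcases hcomp a with ha | ha
  · exact ⟨a, by simp [hi], hσ a ha⟩
  · have hb : b ∈ S := hcl _ ha _ ⟨i, by rw [hi, lneg_lneg]⟩
    exact ⟨b, by simp [hi], hσ b hb⟩

def IsWalk {n m : ℕ} (ξ : Fin m → Finset (Lit n)) (p : ℕ → Lit n) : Prop :=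
  ∀ i, REdge ξ (p i) (p (i+1))

lemma walk_cons {n m : ℕ} {ξ : Fin m → Finset (Lit n)} {a b : Lit n} (h : Reach ξ a b)
    {q : ℕ → Lit n} (hq : IsWalk ξ q) (hb : q 0 = b) :
    ∃ p : ℕ → Lit n, ∃ r, IsWalk ξ p ∧ p 0 = a ∧ p r = b := by
  induction h using Relation.ReflTransGen.head_induction_on with
  | refl => exact ⟨q, 0, hq, hb, hb⟩
  | head h1 h1r ih =>
    rename_i a c
    obtain ⟨p, r, hp, h0, hr⟩ := ih
    refine ⟨fun i => Nat.casesOn i a p, r + 1, ?_, rfl, hr⟩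
    intro i
    cases i with
    | zero => simpa [h0] using h1
    | succ i => exact hp i

lemma exists_walk {n m : ℕ} (ξ : Fin m → Finset (Lit n)) (h2 : ∀ i, (ξ i).card = 2)
    (hns : ¬ SatF ξ) : ∃ r : ℕ, ∃ p : ℕ → Lit n, IsWalk ξ p ∧ p r = lneg (p 0) := by
  classical
  have : ∃ x, Reach ξ x (lneg x) ∧ Reach ξ (lneg x) x := by
    by_contra hc
    push Not at hc
    exact hns (twosat ξ h2 hc)
  obtain ⟨x, h1, h3⟩ := this
  have hnext : ∀ z : {z // Reach ξ z x}, ∃ w : {z // Reach ξ z x}, REdge ξ z.1 w.1 := by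
    rintro ⟨z, hz⟩
    have aux : ∀ z, z ≠ x → Reach ξ z x → ∃ w : {z // Reach ξ z x}, REdge ξ z w.1 := by
      intro z hzx hz
      rcases Relation.ReflTransGen.cases_head hz with h | ⟨c, hc, hcx⟩
      · exact absurd h hzx
      · exact ⟨⟨c, hcx⟩, hc⟩
    by_cases hzx : z = x
    · subst hzx
      rcases Relation.ReflTransGen.cases_head h1 with h | ⟨c, hc, hcx⟩
      · exact absurd h.symm (lneg_ne _)
      · exact ⟨⟨c, hcx.trans h3⟩, hc⟩
    · exact aux z hzx hz
  choose f hf using hnext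
  let q : ℕ → Lit n := fun i => (f^[i] ⟨lneg x, h3⟩).1
  have hq : IsWalk ξ q := by
    intro i
    simp only [q, Function.iterate_succ_apply']
    exact hf _
  obtain ⟨p, r, hp, h0, hr⟩ := walk_cons h1 hq rfl
  exact ⟨r, p, hp, by rw [hr, h0]⟩

lemma exists_lasso {n m : ℕ} (ξ : Fin m → Finset (Lit n)) (h2 : ∀ i, (ξ i).card = 2)
    (hns : ¬ SatF ξ) : ∃ t r j : ℕ, ∃ p : ℕ → Lit n, ∃ ι : Fin t → Fin m,
      0 < r ∧ r < t ∧ j < t ∧ (p r).1 = (p 0).1 ∧ (p t).1 = (p j).1 ∧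
      Function.Injective ι ∧ ∀ e : Fin t, ξ (ι e) = {lneg (p e), p (e + 1)} := by
  classical
  have hex := exists_walk ξ h2 hns
  let r := Nat.find hex
  obtain ⟨p, hp, hpr⟩ : ∃ p : ℕ → Lit n, IsWalk ξ p ∧ p r = lneg (p 0) := Nat.find_spec hex
  have hmin : ∀ s < r, ∀ q : ℕ → Lit n, IsWalk ξ q → q s ≠ lneg (q 0) := by
    intro s hs q hq hc
    exact Nat.find_min hex hs ⟨q, hq, hc⟩
  have hr0 : 0 < r := by
    rcases Nat.eq_zero_or_pos r with h | h
    · rw [h] at hpr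
      exact absurd hpr.symm (lneg_ne _)
    · exact h
  have hdist : ∀ a b, a < b → b ≤ r → (p b).1 = (p a).1 → a = 0 ∧ b = r := by
    intro a b hab hbr hv
    rcases lit_cases hv with h | h
    · exfalso
      refine hmin (r - (b - a)) (by omega) (fun i => if i ≤ a then p i else p (i + (b - a))) ?_ ?_
      · intro i
        by_cases h1 : i + 1 ≤ a
        · have h3 : i ≤ a := by omega
          simp only [h1, h3, if_true]
          exact hp i
        · by_cases h3 : i ≤ a
          · have : i = a := by omega
            subst this
            simp only [h1, le_refl, if_true, if_false]
            rw [← h]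
            have : i + 1 + (b - i) = b + 1 := by omega
            rw [this]
            exact hp b
          · simp only [h1, h3, if_false]
            have : i + 1 + (b - a) = (i + (b - a)) + 1 := by omega
            rw [this]
            exact hp _
      · simp only [Nat.zero_le, if_true]
        rw [← hpr]
        split_ifs with h1
        · have h3 : r - (b - a) = a := by omega
          have h4 : b = r := by omega
          rw [h3, ← h, h4]
        · congr 1
          omega
    · by_contra hc
      refine hmin (b - a) (by omega) (fun i => p (a + i)) (fun i => hp (a + i)) ?_
      simp only [Nat.add_zero]
      rw [← h]
      congr 1
      omega
  have hrep : ∃ t, r < t ∧ ∃ j < t, (p t).1 = (p j).1 := by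
    have := not_injective_infinite_finite (fun k : ℕ => (p (r + 1 + k)).1)
    simp only [Function.Injective] at this
    push Not at this
    obtain ⟨a, b, hab, hne⟩ := this
    rcases lt_or_gt_of_ne hne with h | h
    · exact ⟨r + 1 + b, by omega, r + 1 + a, by omega, hab.symm⟩
    · exact ⟨r + 1 + a, by omega, r + 1 + b, by omega, hab⟩
  let t := Nat.find hrep
  obtain ⟨hrt, j, hjt, hj⟩ : r < t ∧ ∃ j < t, (p t).1 = (p j).1 := Nat.find_spec hrep
  have htmin : ∀ s < t, r < s → ∀ j < s, (p s).1 ≠ (p j).1 := by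
    intro s hs hrs j hjs hc
    exact Nat.find_min hrep hs ⟨hrs, j, hjs, hc⟩
  have hdist' : ∀ a b, a < b → b < t → (p b).1 = (p a).1 → a = 0 ∧ b = r := by
    intro a b hab hbt hv
    by_cases hbr : b ≤ r
    · exact hdist a b hab hbr hv
    · exact absurd hv (htmin b hbt (by omega) a hab)
  choose ι hι using fun e : Fin t => hp e
  have hclause : ∀ e e', e < e' → e' < t →
      ({lneg (p e), p (e+1)} : Finset (Lit n)) ≠ {lneg (p e'), p (e'+1)} := by
    intro e e' hee he't heq
    have hmem : lneg (p e') ∈ ({lneg (p e), p (e+1)} : Finset (Lit n)) := by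
      rw [heq]; simp
    simp only [Finset.mem_insert, Finset.mem_singleton] at hmem
    rcases hmem with h | h
    · have h' : p e' = p e := by rw [← lneg_lneg (p e'), h, lneg_lneg]
      obtain ⟨h0, hr⟩ := hdist' e e' hee he't (by rw [h'])
      subst h0
      rw [hr, hpr] at h'
      exact lneg_ne _ h'
    · rcases Nat.lt_or_ge (e+1) e' with hlt | hge
      · have := hdist' (e+1) e' hlt he't (by rw [← h]; rfl)
        omega
      · have : e + 1 = e' := by omega
        rw [this] at h
        exact lneg_ne _ h
  refine ⟨t, r, j, p, ι, hr0, hrt, hjt, by rw [hpr]; rfl, hj, ?_, hι⟩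
  intro e e' he
  by_contra hne
  have h1 := hι e
  have h3 := hι e'
  rw [he] at h1
  rw [h1] at h3
  rcases lt_or_gt_of_ne hne with h | h
  · exact hclause e e' h e'.2 h3
  · exact hclause e' e h e.2 h3.symm

open Classical in
/-- product weight of an event -/
noncomputable def wt {α : Type*} [Fintype α] {m : ℕ} (p : α → ℝ) (U : (Fin m → α) → Prop) : ℝ :=
  ∑ ξ : Fin m → α, if U ξ then ∏ i, p (ξ i) else 0

lemma wt_union {α X : Type*} [Fintype α] [Fintype X] {m : ℕ} (p : α → ℝ) (hp : ∀ a, 0 ≤ p a)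
    (U : (Fin m → α) → Prop) (E : X → (Fin m → α) → Prop) (h : ∀ ξ, U ξ → ∃ x, E x ξ) :
    wt p U ≤ ∑ x, wt p (E x) := by
  classical
  unfold wt
  rw [Finset.sum_comm]
  refine Finset.sum_le_sum fun ξ _ => ?_
  have h0 : 0 ≤ ∏ i, p (ξ i) := Finset.prod_nonneg fun i _ => hp _
  split_ifs with hU
  · obtain ⟨x, hx⟩ := h ξ hU
    have := Finset.single_le_sum (f := fun x => if E x ξ then ∏ i, p (ξ i) else 0)
      (fun x _ => by positivity) (Finset.mem_univ x)
    simpa [hx] using this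
  · exact Finset.sum_nonneg fun x _ => by split_ifs <;> simp [h0]

lemma wt_false {α : Type*} [Fintype α] {m : ℕ} (p : α → ℝ) (U : (Fin m → α) → Prop)
    (h : ∀ ξ, ¬ U ξ) : wt p U = 0 := by
  unfold wt
  exact Finset.sum_eq_zero fun ξ _ => by simp [h ξ]

lemma wt_box {α : Type*} [Fintype α] {m t : ℕ} (p : α → ℝ) (hsum : ∑ a, p a = 1)
    (ι : Fin t → Fin m) (hι : Function.Injective ι) (c : Fin t → α) :
    wt p (fun ξ => ∀ e, ξ (ι e) = c e) = ∏ e, p (c e) := by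
  classical
  unfold wt
  have h1 : ∀ ξ : Fin m → α, (if (∀ e, ξ (ι e) = c e) then ∏ i, p (ξ i) else 0)
      = ∏ i, (if ∀ e, ι e = i → ξ i = c e then p (ξ i) else 0) := by
    intro ξ
    split_ifs with h
    · refine Finset.prod_congr rfl fun i _ => ?_
      rw [if_pos]
      rintro e rfl
      exact h e
    · push Not at h
      obtain ⟨e, he⟩ := h
      symm
      refine Finset.prod_eq_zero (Finset.mem_univ (ι e)) ?_
      rw [if_neg]
      intro h
      exact he (h e rfl)
  refine (Finset.sum_congr rfl (g := fun ξ : Fin m → α =>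
    ∏ i, (if ∀ e, ι e = i → ξ i = c e then p (ξ i) else 0)) fun ξ _ => ?_).trans ?_
  · rw [← h1]
    congr
  rw [← Fintype.prod_sum (fun i a => if ∀ e, ι e = i → a = c e then p a else 0)]
  rw [← Finset.prod_subset (Finset.subset_univ (Finset.univ.image ι))]
  · rw [Finset.prod_image (fun a _ b _ h => hι h)]
    refine Finset.prod_congr rfl fun e _ => ?_
    rw [Finset.sum_eq_single (c e)]
    · rw [if_pos]
      intro e' he'
      rw [hι he']
    · intro b _ hb
      rw [if_neg]
      intro h
      exact hb (h e rfl)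
    · simp
  · intro i _ hi
    rw [← hsum]
    refine Finset.sum_congr rfl fun a _ => ?_
    rw [if_pos]
    intro e he
    exact absurd (Finset.mem_image.2 ⟨e, Finset.mem_univ _, he⟩) hi

lemma card_good {n t : ℕ} (r j : Fin (t+1)) (hr0 : r ≠ 0) (hr : r ≠ Fin.last t)
    (hj : j ≠ Fin.last t) :
    Fintype.card {v : Fin (t+1) → Fin n // v r = v 0 ∧ v (Fin.last t) = v j} * n * n
      ≤ n ^ (t+1) := by
  classical
  have : Function.Injective (fun x : ({v : Fin (t+1) → Fin n // v r = v 0 ∧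
      v (Fin.last t) = v j} × Fin n) × Fin n =>
      Function.update (Function.update x.1.1.1 r x.1.2) (Fin.last t) x.2) := by
    rintro ⟨⟨⟨v, hv1, hv2⟩, x⟩, y⟩ ⟨⟨⟨v', hv1', hv2'⟩, x'⟩, y'⟩ h
    simp only at h
    have hi : ∀ i, i ≠ r → i ≠ Fin.last t → v i = v' i := by
      intro i h1 h2
      have := congrFun h i
      simpa [Function.update_of_ne, h1, h2] using this
    have hx : x = x' := by
      have := congrFun h r
      simpa [Function.update_of_ne, hr] using this
    have hy : y = y' := by
      have := congrFun h (Fin.last t)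
      simpa using this
    have ht0 : (0 : Fin (t+1)) ≠ Fin.last t := by
      intro h0
      have hr' := r.2
      have : t = 0 := by
        have := congrArg Fin.val h0
        simpa using this.symm
      subst this
      exact hr0 (Fin.ext (by simp only [Fin.val_zero]; omega))
    have h0 : v 0 = v' 0 := hi 0 hr0.symm ht0
    have hvr : v r = v' r := by rw [hv1, hv1', h0]
    have hall : ∀ i, i ≠ Fin.last t → v i = v' i := by
      intro i h2
      by_cases h1 : i = r
      · rw [h1, hvr]
      · exact hi i h1 h2
    have hv : v = v' := by
      funext i
      by_cases h2 : i = Fin.last t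
      · rw [h2, hv2, hv2', hall j hj]
      · exact hall i h2
    subst hv hx hy
    rfl
  have h := Fintype.card_le_of_injective _ this
  simpa [Fintype.card_prod] using h

lemma signs_sum_le (M : Bool → Bool → ℝ) (h : Bool → ℝ) (lam : ℝ) (hM : ∀ a b, 0 ≤ M a b)
    (hh : ∀ a, 1 ≤ h a)
    (hlam : ∀ a, ∑ b, M a b * h b ≤ lam * h a) (hl0 : 0 ≤ lam) (t : ℕ) :
    ∑ s : Fin (t+1) → Bool, ∏ e : Fin t, M (s e.castSucc) (s e.succ) ≤ lam ^ t * ∑ a, h a := by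
  have key : ∀ t : ℕ, ∀ a, ∑ s : Fin t → Bool, ∏ e : Fin t,
      M ((Fin.cons a s : Fin (t+1) → Bool) e.castSucc) ((Fin.cons a s : Fin (t+1) → Bool) e.succ)
      ≤ lam ^ t * h a := by
    intro t
    induction t with
    | zero => intro a; simpa using hh a
    | succ t ih =>
      intro a
      rw [← (Fin.consEquiv (fun _ : Fin (t+1) => Bool)).sum_comp, Fintype.sum_prod_type]
      have : ∀ b : Bool, ∑ s : Fin t → Bool, ∏ e : Fin (t+1),
          M ((Fin.cons a (Fin.cons b s : Fin (t+1) → Bool) : Fin (t+2) → Bool) e.castSucc)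
            ((Fin.cons a (Fin.cons b s : Fin (t+1) → Bool) : Fin (t+2) → Bool) e.succ)
          ≤ M a b * (lam ^ t * h b) := by
        intro b
        calc _ = M a b * ∑ s : Fin t → Bool, ∏ e : Fin t,
              M ((Fin.cons b s : Fin (t+1) → Bool) e.castSucc)
                ((Fin.cons b s : Fin (t+1) → Bool) e.succ) := by
              rw [Finset.mul_sum]
              refine Finset.sum_congr rfl fun s _ => ?_
              rw [Fin.prod_univ_succ]
              rfl
          _ ≤ _ := mul_le_mul_of_nonneg_left (ih b) (hM a b)
      calc _ ≤ ∑ b, M a b * (lam ^ t * h b) := Finset.sum_le_sum fun b _ => this b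
        _ = lam ^ t * ∑ b, M a b * h b := by
            rw [Finset.mul_sum]; exact Finset.sum_congr rfl fun b _ => by ring
        _ ≤ lam ^ t * (lam * h a) := mul_le_mul_of_nonneg_left (hlam a) (by positivity)
        _ = _ := by ring
  rw [← (Fin.consEquiv (fun _ : Fin (t+1) => Bool)).sum_comp, Fintype.sum_prod_type, Finset.mul_sum]
  exact Finset.sum_le_sum fun a _ => key t a

def lits {n t : ℕ} (v : Fin (t+1) → Fin n) (s : Fin (t+1) → Bool) (e : Fin t) : Finset (Lit n) :=
  {lneg (v e.castSucc, s e.castSucc), (v e.succ, s e.succ)}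

def LassoAt {n m : ℕ} (t : ℕ) (r j : Fin (t+1)) (ξ : Fin m → Finset (Lit n)) : Prop :=
  ∃ x : {v : Fin (t+1) → Fin n // v r = v 0 ∧ v (Fin.last t) = v j} ×
    (Fin (t+1) → Bool) × {ι : Fin t → Fin m // Function.Injective ι},
    ∀ e, ξ (x.2.2.1 e) = lits x.1.1 x.2.1 e

lemma lasso_wt {n m : ℕ} (hn : 0 < n) (p : Finset (Lit n) → ℝ) (hp : ∀ a, 0 ≤ p a)
    (hsum : ∑ a, p a = 1) (M : Bool → Bool → ℝ) (h : Bool → ℝ) (lam : ℝ)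
    (hM : ∀ a b, 0 ≤ M a b) (hh : ∀ a, 1 ≤ h a)
    (hlam : ∀ a, ∑ b, M a b * h b ≤ lam * h a) (hl0 : 0 ≤ lam)
    (hpM : ∀ a b : Lit n, m * p {lneg a, b} ≤ M a.2 b.2 / n) (t : ℕ) (r j : Fin (t+1))
    (hr0 : r ≠ 0) (hr : r ≠ Fin.last t) (hj : j ≠ Fin.last t) :
    wt p (fun ξ : Fin m → Finset (Lit n) => LassoAt t r j ξ) ≤ lam ^ t * (∑ a, h a) / n := by
  classical
  have hn' : (0 : ℝ) < n := by exact_mod_cast hn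
  refine (wt_union p hp _ _ (fun ξ hξ => hξ)).trans ?_
  rw [Fintype.sum_prod_type]
  simp_rw [Fintype.sum_prod_type]
  have h1 : ∀ (v : {v : Fin (t+1) → Fin n // v r = v 0 ∧ v (Fin.last t) = v j})
      (s : Fin (t+1) → Bool),
      ∑ ι : {ι : Fin t → Fin m // Function.Injective ι},
        wt p (fun ξ : Fin m → Finset (Lit n) => ∀ e, ξ (ι.1 e) = lits v.1 s e)
      ≤ (∏ e : Fin t, M (s e.castSucc) (s e.succ)) / (n : ℝ) ^ t := by
    intro v s
    have : ∀ ι : {ι : Fin t → Fin m // Function.Injective ι},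
        wt p (fun ξ : Fin m → Finset (Lit n) => ∀ e, ξ (ι.1 e) = lits v.1 s e)
        = ∏ e, p (lits v.1 s e) := fun ι => wt_box p hsum ι.1 ι.2 _
    simp_rw [this]
    rw [Finset.sum_const, nsmul_eq_mul, Finset.card_univ]
    have hc : (Fintype.card {ι : Fin t → Fin m // Function.Injective ι} : ℝ) ≤ (m : ℝ) ^ t := by
      have := Fintype.card_subtype_le (fun ι : Fin t → Fin m => Function.Injective ι)
      simp only [Fintype.card_pi, Fintype.card_fin, Finset.prod_const, Finset.card_univ] at this
      exact_mod_cast this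
    have hnn : 0 ≤ ∏ e, p (lits v.1 s e) := Finset.prod_nonneg fun e _ => hp _
    calc _ ≤ (m : ℝ) ^ t * ∏ e, p (lits v.1 s e) := mul_le_mul_of_nonneg_right hc hnn
      _ = ∏ e, ((m : ℝ) * p (lits v.1 s e)) := by
          rw [Finset.prod_mul_distrib]; simp
      _ ≤ ∏ e : Fin t, (M (s e.castSucc) (s e.succ) / (n : ℝ)) := by
          refine Finset.prod_le_prod (fun e _ => mul_nonneg (by positivity) (hp _)) fun e _ => ?_
          exact hpM (v.1 e.castSucc, s e.castSucc) (v.1 e.succ, s e.succ)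
      _ = _ := by
          rw [Finset.prod_div_distrib]; simp
  have hcard := card_good (n := n) r j hr0 hr hj
  have hcard' : (Fintype.card {v : Fin (t+1) → Fin n // v r = v 0 ∧ v (Fin.last t) = v j} : ℝ)
      * n * n ≤ (n : ℝ) ^ (t+1) := by exact_mod_cast hcard
  have hS := signs_sum_le M h lam hM hh hlam hl0 t
  set S := ∑ s : Fin (t+1) → Bool, ∏ e : Fin t, M (s e.castSucc) (s e.succ) with hSdef
  have hS0 : 0 ≤ S := Finset.sum_nonneg fun s _ => Finset.prod_nonneg fun e _ => hM _ _
  calc _ ≤ ∑ v : {v : Fin (t+1) → Fin n // v r = v 0 ∧ v (Fin.last t) = v j},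
        ∑ s : Fin (t+1) → Bool, (∏ e : Fin t, M (s e.castSucc) (s e.succ)) / (n : ℝ) ^ t :=
        Finset.sum_le_sum fun v _ => Finset.sum_le_sum fun s _ => h1 v s
    _ = (Fintype.card {v : Fin (t+1) → Fin n // v r = v 0 ∧ v (Fin.last t) = v j} : ℝ) *
        (S / (n : ℝ) ^ t) := by
        rw [Finset.sum_const, nsmul_eq_mul, Finset.card_univ, ← Finset.sum_div]
    _ ≤ S / n := by
        rw [mul_div_assoc', div_le_div_iff₀ (by positivity) hn']
        have : (Fintype.card {v : Fin (t+1) → Fin n // v r = v 0 ∧ v (Fin.last t) = v j} : ℝ) * n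
            ≤ (n : ℝ) ^ t := by
          rw [pow_succ] at hcard'
          exact le_of_mul_le_mul_right hcard' hn'
        nlinarith
    _ ≤ _ := div_le_div_of_nonneg_right hS hn'.le

lemma unsat_wt {n m : ℕ} (hn : 0 < n) (p : Finset (Lit n) → ℝ) (hp : ∀ a, 0 ≤ p a)
    (hsum : ∑ a, p a = 1) (M : Bool → Bool → ℝ) (h : Bool → ℝ) (lam : ℝ)
    (hM : ∀ a b, 0 ≤ M a b) (hh : ∀ a, 1 ≤ h a)
    (hlam : ∀ a, ∑ b, M a b * h b ≤ lam * h a) (hl0 : 0 ≤ lam)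
    (hpM : ∀ a b : Lit n, m * p {lneg a, b} ≤ M a.2 b.2 / n) :
    wt p (fun ξ : Fin m → Finset (Lit n) => (∀ i, (ξ i).card = 2) ∧ ¬ SatF ξ) ≤
      (∑ t ∈ Finset.range (m+1), ((t : ℝ) + 1) ^ 2 * lam ^ t) * ((∑ a, h a) / n) := by
  classical
  have hn' : (0 : ℝ) < n := by exact_mod_cast hn
  refine (wt_union (X := Fin (m+1)) p hp _ (fun t ξ => ∃ x : Fin (t+1) × Fin (t+1),
    (x.1 ≠ 0 ∧ x.1 ≠ Fin.last t ∧ x.2 ≠ Fin.last t) ∧ LassoAt t x.1 x.2 ξ) ?_).trans ?_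
  · rintro ξ ⟨h2, hns⟩
    obtain ⟨t, r, j, p, ι, hr0, hrt, hjt, h3, h4, hinj, hι⟩ := exists_lasso ξ h2 hns
    have htm : t ≤ m := by simpa using Fintype.card_le_of_injective ι hinj
    refine ⟨⟨t, by omega⟩, ⟨⟨r, by simp only; omega⟩, ⟨j, by simp only; omega⟩⟩, ⟨?_, ?_, ?_⟩, ?_⟩
    · intro h; have := congrArg Fin.val h; simp at this; omega
    · intro h; have := congrArg Fin.val h; simp at this; omega
    · intro h; have := congrArg Fin.val h; simp at this; omega
    · refine ⟨⟨⟨fun i => (p i).1, ?_⟩, fun i => (p i).2, ⟨ι, hinj⟩⟩, ?_⟩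
      · exact ⟨by simpa using h3, by simpa using h4⟩
      · intro e
        simpa [lits] using hι e
  · rw [← Fin.sum_univ_eq_sum_range (fun t => ((t : ℝ) + 1) ^ 2 * lam ^ t), Finset.sum_mul]
    refine Finset.sum_le_sum fun t _ => ?_
    refine (wt_union p hp _ _ (fun ξ hξ => hξ)).trans ?_
    have : ∀ x : Fin ((t : ℕ)+1) × Fin ((t : ℕ)+1), wt p (fun ξ : Fin m → Finset (Lit n) =>
        (x.1 ≠ 0 ∧ x.1 ≠ Fin.last t ∧ x.2 ≠ Fin.last t) ∧ LassoAt t x.1 x.2 ξ)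
        ≤ lam ^ (t : ℕ) * (∑ a, h a) / n := by
      intro x
      by_cases hx : x.1 ≠ 0 ∧ x.1 ≠ Fin.last t ∧ x.2 ≠ Fin.last t
      · have := lasso_wt hn p hp hsum M h lam hM hh hlam hl0 hpM t x.1 x.2 hx.1 hx.2.1 hx.2.2
        simpa [hx] using this
      · rw [wt_false _ _ (fun ξ hξ => hx hξ.1)]
        have : 0 ≤ ∑ a, h a := Finset.sum_nonneg fun a _ => by linarith [hh a]
        positivity
    refine (Finset.sum_le_sum fun x _ => this x).trans ?_
    rw [Finset.sum_const, nsmul_eq_mul, Finset.card_univ, Fintype.card_prod, Fintype.card_fin]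
    push_cast
    apply le_of_eq
    ring

lemma transfer {Ω α : Type*} [Fintype Ω] [Fintype α] {m : ℕ} (κ : Ω → α → ℝ)
    (h0 : ∀ ω c, 0 ≤ κ ω c) (h1 : ∀ ω, ∑ c, κ ω c = 1)
    (B : (Fin m → Ω) → Prop) (U : (Fin m → α) → Prop)
    (hBU : ∀ A ξ, B A → (∀ i, κ (A i) (ξ i) ≠ 0) → U ξ) :
    unifProb B ≤ wt (fun c => (∑ ω, κ ω c) / (Fintype.card Ω : ℝ)) U := by
  classical
  have hcard : (Nat.card {A // B A} : ℝ) = ∑ A : Fin m → Ω, if B A then (1 : ℝ) else 0 := by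
    rw [Nat.card_eq_fintype_card, Fintype.card_subtype]
    simp
  have key : ∑ A : Fin m → Ω, (if B A then (1 : ℝ) else 0) ≤
      ∑ ξ : Fin m → α, if U ξ then ∏ i, (∑ ω, κ ω (ξ i)) else 0 := by
    have e1 : ∀ A : Fin m → Ω, (if B A then (1 : ℝ) else 0) =
        ∑ ξ : Fin m → α, if B A then ∏ i, κ (A i) (ξ i) else 0 := by
      intro A
      split_ifs
      · rw [← Fintype.prod_sum (fun i c => κ (A i) c)]
        simp [h1]
      · simp
    simp_rw [e1]
    rw [Finset.sum_comm]
    refine Finset.sum_le_sum fun ξ _ => ?_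
    split_ifs with hU
    · rw [Fintype.prod_sum (fun i ω => κ ω (ξ i))]
      refine Finset.sum_le_sum fun A _ => ?_
      split_ifs
      · exact le_rfl
      · exact Finset.prod_nonneg fun i _ => h0 _ _
    · refine (Finset.sum_eq_zero fun A _ => ?_).le
      split_ifs with hB
      · by_contra hc
        refine hU (hBU A ξ hB fun i hi => hc ?_)
        exact Finset.prod_eq_zero (Finset.mem_univ i) hi
      · rfl
  unfold unifProb
  rw [hcard]
  refine (div_le_div_of_nonneg_right key (by positivity)).trans (le_of_eq ?_)
  unfold wt
  rw [Finset.sum_div]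
  refine Finset.sum_congr rfl fun ξ _ => ?_
  split_ifs
  · rw [Finset.prod_div_distrib]
    simp
  · simp

noncomputable def wC {n : ℕ} (C : Clause n 3) : ℝ := if 2 ≤ C.posCount then 31/16 else 1/16

lemma select_five {n : ℕ} (h : 0 < 5) (ω : Fin 5 → Clause n 3) : select h ω =
    if 2 ≤ (ω 0).posCount then ω 0 else if 2 ≤ (ω 1).posCount then ω 1 else
    if 2 ≤ (ω 2).posCount then ω 2 else if 2 ≤ (ω 3).posCount then ω 3 else ω 4 := by
  unfold select
  have : List.finRange 5 = [0, 1, 2, 3, 4] := by decide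
  rw [this]
  by_cases h0 : 2 ≤ (ω 0).posCount
  · simp [List.find?, h0]
  by_cases h1 : 2 ≤ (ω 1).posCount
  · simp [List.find?, h0, h1]
  by_cases h2 : 2 ≤ (ω 2).posCount
  · simp [List.find?, h0, h1, h2]
  by_cases h3 : 2 ≤ (ω 3).posCount
  · simp [List.find?, h0, h1, h2, h3]
  · simp [List.find?, h0, h1, h2, h3]

def flipC {n k : ℕ} (C : Clause n k) : Clause n k :=
  ⟨C.1.image lneg, by
    have hinj : Function.Injective (lneg : Lit n → Lit n) :=
      Function.LeftInverse.injective lneg_lneg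
    refine ⟨by rw [Finset.card_image_of_injective _ hinj, C.2.1], ?_⟩
    rw [Finset.image_image]
    exact C.2.2⟩

lemma flipC_inj {n k : ℕ} : Function.Injective (flipC : Clause n k → Clause n k) := by
  intro C D h
  have hinj : Function.Injective (lneg : Lit n → Lit n) :=
      Function.LeftInverse.injective lneg_lneg
  apply Subtype.ext
  exact Finset.image_injective hinj (congrArg Subtype.val h)

lemma pos_add_neg {n k : ℕ} (C : Clause n k) :
    C.posCount + (C.1.filter fun p => p.2 = false).card = k := by
  have := Finset.card_filter_add_card_filter_not (s := C.1) (fun p : Lit n => p.2 = true)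
  rw [C.2.1] at this
  simpa [Clause.posCount] using this

lemma flip_pos {n k : ℕ} (C : Clause n k) : (flipC C).posCount + C.posCount = k := by
  have hinj : Function.Injective (lneg : Lit n → Lit n) :=
      Function.LeftInverse.injective lneg_lneg
  have h := pos_add_neg C
  have : (flipC C).posCount = (C.1.filter fun p => p.2 = false).card := by
    unfold Clause.posCount flipC
    rw [Finset.filter_image, Finset.card_image_of_injective _ hinj]
    congr 1
    ext p
    simp [lneg]
  omega

lemma bad_le {n : ℕ} : 2 * (Finset.univ.filter fun C : Clause n 3 => ¬ 2 ≤ C.posCount).card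
    ≤ Fintype.card (Clause n 3) := by
  have h1 := Finset.card_filter_add_card_filter_not (s := (Finset.univ : Finset (Clause n 3)))
    (fun C => 2 ≤ C.posCount)
  have h2 : (Finset.univ.filter fun C : Clause n 3 => ¬ 2 ≤ C.posCount).card ≤
      (Finset.univ.filter fun C : Clause n 3 => 2 ≤ C.posCount).card := by
    refine Finset.card_le_card_of_injOn flipC ?_ (fun a _ b _ h => flipC_inj h)
    intro C hC
    have := flip_pos C
    simp at hC ⊢
    omega
  rw [Finset.card_univ] at h1
  omega

lemma poly_bd {β N G F : ℝ} (hβ : β ≤ N / 2) (hB0 : 0 ≤ β) (hN : 0 ≤ N) (hG : 0 ≤ G)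
    (hF : 0 ≤ F) : G * N * N * N * N + β * G * N * N * N + β * β * G * N * N + β * β * β * G * N +
        β * β * β * β * F ≤ N ^ 4 * (15/8 * G + 1/16 * F) := by
  calc G * N * N * N * N + β * G * N * N * N + β * β * G * N * N + β * β * β * G * N +
        β * β * β * β * F
      ≤ G * N * N * N * N + (N/2) * G * N * N * N + (N/2) * (N/2) * G * N * N +
        (N/2) * (N/2) * (N/2) * G * N + (N/2) * (N/2) * (N/2) * (N/2) * F := by gcongr
    _ = _ := by ring

lemma select_sum {n : ℕ} (h : 0 < 5) (f : Clause n 3 → ℝ) (hf : ∀ C, 0 ≤ f C) :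
    ∑ ω : Fin 5 → Clause n 3, f (select h ω) ≤
      (Fintype.card (Clause n 3) : ℝ) ^ 4 * ∑ C, wC C * f C := by
  classical
  set g : Clause n 3 → ℝ := fun C => if 2 ≤ C.posCount then f C else 0 with hg
  set b : Clause n 3 → ℝ := fun C => if 2 ≤ C.posCount then 0 else 1 with hb
  set u : Clause n 3 → ℝ := fun C => 1 with hu
  have hpt : ∀ ω : Fin 5 → Clause n 3, f (select h ω) =
      g (ω 0) * u (ω 1) * u (ω 2) * u (ω 3) * u (ω 4) +
      b (ω 0) * g (ω 1) * u (ω 2) * u (ω 3) * u (ω 4) +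
      b (ω 0) * b (ω 1) * g (ω 2) * u (ω 3) * u (ω 4) +
      b (ω 0) * b (ω 1) * b (ω 2) * g (ω 3) * u (ω 4) +
      b (ω 0) * b (ω 1) * b (ω 2) * b (ω 3) * f (ω 4) := by
    intro ω
    rw [select_five]
    simp only [hg, hb, hu]
    split_ifs <;> simp
  have hprod : ∀ f0 f1 f2 f3 f4 : Clause n 3 → ℝ,
      ∑ ω : Fin 5 → Clause n 3, f0 (ω 0) * f1 (ω 1) * f2 (ω 2) * f3 (ω 3) * f4 (ω 4) =
      (∑ C, f0 C) * (∑ C, f1 C) * (∑ C, f2 C) * (∑ C, f3 C) * (∑ C, f4 C) := by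
    intro f0 f1 f2 f3 f4
    have := Fintype.prod_sum (fun (i : Fin 5) (C : Clause n 3) =>
      (![f0, f1, f2, f3, f4] : Fin 5 → Clause n 3 → ℝ) i C)
    simp only [Fin.prod_univ_five] at this
    exact this.symm
  simp_rw [hpt]
  simp only [Finset.sum_add_distrib, hprod]
  have hU : ∑ C, u C = (Fintype.card (Clause n 3) : ℝ) := by simp [hu]
  have hB : 2 * ∑ C, b C ≤ (Fintype.card (Clause n 3) : ℝ) := by
    have h1 : ∑ C, b C = ((Finset.univ.filter fun C : Clause n 3 => ¬ 2 ≤ C.posCount).card : ℝ) := by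
      rw [Finset.card_filter]
      push_cast
      refine Finset.sum_congr rfl fun C _ => ?_
      simp only [hb]
      split_ifs <;> simp_all
    rw [h1]
    exact_mod_cast bad_le (n := n)
  have hB0 : 0 ≤ ∑ C, b C := Finset.sum_nonneg fun C _ => by simp only [hb]; split_ifs <;> simp
  have hG0 : 0 ≤ ∑ C, g C := Finset.sum_nonneg fun C _ => by
    simp only [hg]; split_ifs; exacts [hf C, le_rfl]
  have hF0 : 0 ≤ ∑ C, f C := Finset.sum_nonneg fun C _ => hf C
  have hW : ∑ C, wC C * f C = 15/8 * ∑ C, g C + 1/16 * ∑ C, f C := by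
    rw [Finset.mul_sum, Finset.mul_sum, ← Finset.sum_add_distrib]
    refine Finset.sum_congr rfl fun C _ => ?_
    simp only [hg, wC]
    split_ifs <;> ring
  rw [hU, hW]
  set N := (Fintype.card (Clause n 3) : ℝ)
  set β := ∑ C, b C
  set G := ∑ C, g C
  set F := ∑ C, f C
  have hβ : β ≤ N / 2 := by linarith
  have hN : 0 ≤ N := by linarith
  exact poly_bd hβ hB0 hN hG0 hF0

lemma card_clause {n : ℕ} : 8 * n.choose 3 ≤ Fintype.card (Clause n 3) := by
  classical
  have h1 : ((Finset.powersetCard 3 (Finset.univ : Finset (Fin n))).sigma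
      (fun S => S.powerset)).card = 8 * n.choose 3 := by
    rw [Finset.card_sigma, Finset.sum_congr rfl (g := fun _ => 8)]
    · simp [mul_comm]
    · intro S hS
      rw [Finset.card_powerset, (Finset.mem_powersetCard.1 hS).2]
      norm_num
  rw [← h1, Fintype.card_subtype]
  refine Finset.card_le_card_of_injOn (fun x => x.1.image (fun v => (v, decide (v ∈ x.2)))) ?_ ?_
  · rintro ⟨S, T⟩ hx
    simp only [Finset.coe_sigma, Set.mem_sigma_iff, Finset.mem_coe, Finset.mem_powersetCard] at hx
    simp only [Finset.coe_filter, Finset.mem_univ, true_and, Set.mem_ofPred_eq]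
    constructor
    · rw [Finset.card_image_of_injective _ (fun a b h => (Prod.ext_iff.1 h).1)]
      exact hx.1.2
    · rw [Finset.image_image]
      have : (Prod.fst ∘ fun v : Fin n => (v, decide (v ∈ T))) = id := rfl
      rw [this, Finset.image_id]
      exact hx.1.2
  · rintro ⟨S, T⟩ hx ⟨S', T'⟩ hx' h
    simp only [Finset.coe_sigma, Set.mem_sigma_iff, Finset.mem_coe, Finset.mem_powerset] at hx hx'
    simp only at h
    have hS : S = S' := by
      have := congrArg (Finset.image Prod.fst) h
      rw [Finset.image_image, Finset.image_image] at this
      have e : ∀ T : Finset (Fin n), (Prod.fst ∘ fun v : Fin n => (v, decide (v ∈ T))) = id :=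
        fun _ => rfl
      rwa [e, e, Finset.image_id, Finset.image_id] at this
    subst hS
    have hm : ∀ (T : Finset (Fin n)), T ⊆ S → ∀ v, v ∈ T ↔
        (v, true) ∈ S.image (fun v => (v, decide (v ∈ T))) := by
      intro T hT v
      simp only [Finset.mem_image, Prod.mk.injEq, decide_eq_true_eq]
      constructor
      · intro hv; exact ⟨v, hT hv, rfl, hv⟩
      · rintro ⟨w, _, rfl, hw⟩; exact hw
    have hT : T = T' := by
      ext v
      rw [hm T hx.2, hm T' hx'.2, h]
    subst hT
    rfl

noncomputable def kap {n : ℕ} (C : Clause n 3) (l : Lit n) : ℝ :=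
  if C.posCount = 3 then 1/3 else if l.2 = false then 1 / (3 - (C.posCount : ℝ)) else 0

lemma kap_nonneg {n : ℕ} (C : Clause n 3) (l : Lit n) : 0 ≤ kap C l := by
  unfold kap
  have h := pos_add_neg C
  have h3 : (C.posCount : ℝ) ≤ 3 := by exact_mod_cast (by omega : C.posCount ≤ 3)
  split_ifs
  · norm_num
  · apply one_div_nonneg.2; linarith
  · exact le_rfl

lemma kap_sum {n : ℕ} (C : Clause n 3) : ∑ l ∈ C.1, kap C l = 1 := by
  unfold kap
  have h := pos_add_neg C
  by_cases h3 : C.posCount = 3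
  · simp [h3, C.2.1]
  · simp only [h3, if_false]
    rw [← Finset.sum_filter, Finset.sum_const, nsmul_eq_mul]
    have hlt : (C.posCount : ℝ) < 3 := by exact_mod_cast (by omega : C.posCount < 3)
    have : ((C.1.filter fun p => p.2 = false).card : ℝ) = 3 - (C.posCount : ℝ) := by
      have : ((C.posCount + (C.1.filter fun p => p.2 = false).card : ℕ) : ℝ) = (3 : ℕ) := by rw [h]
      push_cast at this
      linarith
    rw [this]
    field_simp [(by linarith : (3 - (C.posCount : ℝ)) ≠ 0)]

noncomputable def kapp {n : ℕ} (C : Clause n 3) (c : Finset (Lit n)) : ℝ :=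
  ∑ l ∈ C.1, if C.1.erase l = c then kap C l else 0

lemma kapp_nonneg {n : ℕ} (C : Clause n 3) (c : Finset (Lit n)) : 0 ≤ kapp C c :=
  Finset.sum_nonneg fun l _ => by split_ifs; exacts [kap_nonneg C l, le_rfl]

lemma kapp_sum {n : ℕ} (C : Clause n 3) : ∑ c, kapp C c = 1 := by
  unfold kapp
  rw [Finset.sum_comm, ← kap_sum C]
  exact Finset.sum_congr rfl fun l _ => by simp

lemma kapp_ne {n : ℕ} {C : Clause n 3} {c : Finset (Lit n)} (h : kapp C c ≠ 0) :
    c.card = 2 ∧ c ⊆ C.1 := by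
  obtain ⟨l, hl, h1⟩ := Finset.exists_ne_zero_of_sum_ne_zero h
  have : C.1.erase l = c := by
    by_contra hc
    simp [hc] at h1
  subst this
  exact ⟨by rw [Finset.card_erase_of_mem hl, C.2.1], Finset.erase_subset _ _⟩

noncomputable def WW (a b : Bool) : ℝ :=
  match a, b with
  | true, true => 31/12
  | false, false => 1/48
  | _, _ => 1/32

noncomputable def W3 (l a b : Bool) : ℝ :=
  match l, a, b with
  | true, true, true => 31/48
  | false, true, true => 31/16
  | false, true, false => 1/32
  | false, false, true => 1/32
  | false, false, false => 1/48
  | _, _, _ => 0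

lemma W3_nonneg (l a b : Bool) : 0 ≤ W3 l a b := by
  cases l <;> cases a <;> cases b <;> simp [W3] <;> norm_num

lemma wkap {n : ℕ} (C : Clause n 3) (l a b : Lit n) (hl : l ∈ C.1) (h : C.1.erase l = {a, b}) :
    wC C * kap C l = W3 l.2 a.2 b.2 := by
  have hC : C.1 = insert l {a, b} := by rw [← h, Finset.insert_erase hl]
  have hl' : l ∉ ({a, b} : Finset (Lit n)) := by rw [← h]; simp
  have hab : a ≠ b := by
    intro hab
    have h2 : (C.1.erase l).card = 2 := by rw [Finset.card_erase_of_mem hl, C.2.1]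
    rw [h, hab] at h2
    simp at h2
  have hpos : C.posCount = (if l.2 = true then 1 else 0) + ((if a.2 = true then 1 else 0) +
      (if b.2 = true then 1 else 0)) := by
    unfold Clause.posCount
    rw [Finset.card_filter, hC, Finset.sum_insert hl', Finset.sum_pair hab]
  unfold wC kap
  rw [hpos]
  rcases l with ⟨l1, l2⟩
  rcases a with ⟨a1, a2⟩
  rcases b with ⟨b1, b2⟩
  cases l2 <;> cases a2 <;> cases b2 <;> norm_num [W3]

lemma pair_sum {n : ℕ} (a b : Lit n) :
    ∑ C : Clause n 3, wC C * kapp C {a, b} ≤ n * WW a.2 b.2 := by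
  classical
  have h1 : ∀ C : Clause n 3, wC C * kapp C {a, b} =
      ∑ l : Lit n, if l ∈ C.1 ∧ C.1.erase l = {a, b} then W3 l.2 a.2 b.2 else 0 := by
    intro C
    unfold kapp
    rw [Finset.mul_sum, ← Finset.sum_subset (Finset.subset_univ C.1)]
    · refine Finset.sum_congr rfl fun l hl => ?_
      by_cases h : C.1.erase l = {a, b}
      · simp only [h, hl, and_self, if_true]
        exact wkap C l a b hl h
      · simp [h]
    · intro l _ hl
      simp [hl]
  simp_rw [h1]
  rw [Finset.sum_comm]
  have h2 : ∀ l : Lit n, ∑ C : Clause n 3,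
      (if l ∈ C.1 ∧ C.1.erase l = {a, b} then W3 l.2 a.2 b.2 else 0) ≤ W3 l.2 a.2 b.2 := by
    intro l
    rw [← Finset.sum_filter, Finset.sum_const, nsmul_eq_mul]
    have hc : (Finset.univ.filter fun C : Clause n 3 =>
        l ∈ C.1 ∧ C.1.erase l = {a, b}).card ≤ 1 := by
      rw [Finset.card_le_one]
      intro C hC D hD
      simp only [Finset.mem_filter, Finset.mem_univ, true_and] at hC hD
      apply Subtype.ext
      rw [← Finset.insert_erase hC.1, ← Finset.insert_erase hD.1, hC.2, hD.2]
    have hc' : ((Finset.univ.filter fun C : Clause n 3 =>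
        l ∈ C.1 ∧ C.1.erase l = {a, b}).card : ℝ) ≤ 1 := by exact_mod_cast hc
    calc _ ≤ 1 * W3 l.2 a.2 b.2 := mul_le_mul_of_nonneg_right hc' (W3_nonneg _ _ _)
      _ = _ := one_mul _
  refine (Finset.sum_le_sum fun l _ => h2 l).trans (le_of_eq ?_)
  rw [Fintype.sum_prod_type]
  simp only [Fintype.sum_bool, Finset.sum_const, Finset.card_univ, Fintype.card_fin, nsmul_eq_mul]
  congr 1
  cases a.2 <;> cases b.2 <;> norm_num [W3, WW]

lemma WW_nonneg (a b : Bool) : 0 ≤ WW a b := by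
  cases a <;> cases b <;> simp [WW] <;> norm_num

noncomputable def pc (n : ℕ) (c : Finset (Lit n)) : ℝ :=
  (∑ ω : Fin 5 → Clause n 3, kapp (select (by norm_num) ω) c) /
    (Fintype.card (Fin 5 → Clause n 3) : ℝ)

lemma card_clause_real {n : ℕ} (hn : 3 ≤ n) :
    4/3 * ((n : ℝ) * (n - 1) * (n - 2)) ≤ (Fintype.card (Clause n 3) : ℝ) := by
  have h1 : (8 * n.choose 3 : ℝ) ≤ (Fintype.card (Clause n 3) : ℝ) := by
    exact_mod_cast card_clause (n := n)
  have h2 : (6 * n.choose 3 : ℝ) = (n : ℝ) * (n - 1) * (n - 2) := by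
    obtain ⟨k, rfl⟩ := Nat.exists_eq_add_of_le' hn
    have := Nat.descFactorial_eq_factorial_mul_choose (k+3) 3
    have h3 : (k+3).descFactorial 3 = (k+1) * ((k+2) * (k+3)) := by
      simp [Nat.descFactorial]
    rw [h3] at this
    have h4 : (((k+1) * ((k+2) * (k+3)) : ℕ) : ℝ) = ((Nat.factorial 3 * (k+3).choose 3 : ℕ) : ℝ) := by
      rw [this]
    push_cast [Nat.factorial] at h4 ⊢
    linarith
  linarith

lemma pc_bound {n : ℕ} (hn : 10000 ≤ n) (a b : Lit n) :
    (⌊(5.06 : ℝ) * n⌋₊ : ℝ) * pc n {lneg a, b} ≤ (5.062 * (3/4) * WW (!a.2) b.2) / n := by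
  have hn' : (10000 : ℝ) ≤ n := by exact_mod_cast hn
  have hN := card_clause_real (n := n) (by omega)
  set N := (Fintype.card (Clause n 3) : ℝ) with hNdef
  have hNpos : 0 < 4/3 * ((n : ℝ) * (n - 1) * (n - 2)) := by
    have h1 : (0:ℝ) < n := by linarith
    have h2 : (0:ℝ) < n - 1 := by linarith
    have h3 : (0:ℝ) < n - 2 := by linarith
    positivity
  have hN0 : 0 < N := lt_of_lt_of_le hNpos hN
  have hm : (⌊(5.06 : ℝ) * n⌋₊ : ℝ) ≤ 5.06 * n := Nat.floor_le (by positivity)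
  have hW := WW_nonneg (!a.2) b.2
  have hp : pc n {lneg a, b} ≤ n * WW (!a.2) b.2 / N := by
    unfold pc
    have h1 := select_sum (n := n) (by norm_num) (fun C => kapp C {lneg a, b})
      (fun C => kapp_nonneg C _)
    have h2 := pair_sum (lneg a) b
    have h3 : (Fintype.card (Fin 5 → Clause n 3) : ℝ) = N ^ 5 := by
      rw [Fintype.card_fun, Fintype.card_fin]; push_cast; rfl
    rw [h3, div_le_div_iff₀ (by positivity) hN0]
    calc _ ≤ (N ^ 4 * (n * WW (!a.2) b.2)) * N :=
          mul_le_mul_of_nonneg_right (h1.trans (mul_le_mul_of_nonneg_left h2 (by positivity))) hN0.le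
      _ = _ := by ring
  calc _ ≤ (5.06 * n) * (n * WW (!a.2) b.2 / N) := by
        refine mul_le_mul hm hp ?_ (by positivity)
        exact div_nonneg (Finset.sum_nonneg fun ω _ => kapp_nonneg _ _) (by positivity)
    _ ≤ (5.06 * n) * (n * WW (!a.2) b.2 / (4/3 * ((n : ℝ) * (n - 1) * (n - 2)))) := by gcongr
    _ ≤ _ := by
        have h2 : (0:ℝ) < n - 1 := by linarith
        have h3 : (0:ℝ) < n - 2 := by linarith
        have h1 : (0:ℝ) < n := by linarith
        rw [mul_div_assoc', div_le_div_iff₀ hNpos h1]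
        have hk : 5.06 * (n:ℝ) * n ≤ 5.062 * ((n - 1) * (n - 2)) := by nlinarith
        calc _ = (n * WW (!a.2) b.2) * (5.06 * (n:ℝ) * n) := by ring
          _ ≤ (n * WW (!a.2) b.2) * (5.062 * ((n - 1) * (n - 2))) := by gcongr
          _ = _ := by ring

lemma pc_nonneg (n : ℕ) (c : Finset (Lit n)) : 0 ≤ pc n c :=
  div_nonneg (Finset.sum_nonneg fun _ _ => kapp_nonneg _ _) (Nat.cast_nonneg _)

lemma pc_sum {n : ℕ} (hn : 3 ≤ n) : ∑ c, pc n c = 1 := by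
  have hN : 0 < Fintype.card (Clause n 3) := by
    have hN := card_clause (n := n)
    have : 0 < n.choose 3 := Nat.choose_pos (by omega)
    omega
  unfold pc
  rw [← Finset.sum_div, Finset.sum_comm]
  simp only [kapp_sum, Finset.sum_const, Finset.card_univ, nsmul_eq_mul, mul_one]
  apply div_self
  rw [Fintype.card_fun, Fintype.card_fin]
  exact_mod_cast (pow_pos hN 5).ne'

lemma transfer_bound (n m : ℕ) :
    unifProb (fun A : Fin m → Fin 5 → Clause n 3 =>
          ¬ Satisfiable (fun i => select (by norm_num) (A i))) ≤
      wt (pc n) (fun ξ : Fin m → Finset (Lit n) => (∀ i, (ξ i).card = 2) ∧ ¬ SatF ξ) := by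
  have h5 : 0 < 5 := by norm_num
  have hs1 : ∀ ω : Fin 5 → Clause n 3, ∑ c, kapp (select h5 ω) c = 1 :=
    fun ω => kapp_sum (select h5 ω)
  have hs0 : ∀ (ω : Fin 5 → Clause n 3) (c : Finset (Lit n)), 0 ≤ kapp (select h5 ω) c :=
    fun ω c => kapp_nonneg (select h5 ω) c
  refine transfer (fun (ω : Fin 5 → Clause n 3) (c : Finset (Lit n)) => kapp (select h5 ω) c)
    hs0 hs1 (fun A : Fin m → Fin 5 → Clause n 3 => ¬ Satisfiable (fun i => select h5 (A i)))
    (fun ξ => (∀ i, (ξ i).card = 2) ∧ ¬ SatF ξ) ?_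
  intro A ξ hA hne
  refine ⟨fun i => (kapp_ne (hne i)).1, ?_⟩
  rintro ⟨σ, hσ⟩
  refine hA ⟨σ, fun i => ?_⟩
  obtain ⟨q, hq, hs⟩ := hσ i
  exact ⟨q, (kapp_ne (hne i)).2 hq, hs⟩

lemma wt_bound {n m : ℕ} (hn : 0 < n) (hn3 : 3 ≤ n)
    (hb : ∀ a b : Lit n, (m : ℝ) * pc n {lneg a, b} ≤ (5.062 * (3/4) * WW (!a.2) b.2) / n) :
    wt (pc n) (fun ξ : Fin m → Finset (Lit n) => (∀ i, (ξ i).card = 2) ∧ ¬ SatF ξ) ≤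
      (∑' t : ℕ, ((t : ℝ) + 1) ^ 2 * (0.9995 : ℝ) ^ t) * (12.136 / n) := by
  have := unsat_wt (n := n) (m := m) hn (pc n) (pc_nonneg n) (pc_sum hn3)
      (fun a b => 5.062 * (3/4) * WW (!a) b) (fun b => if b then 1 else 11.136) 0.9995
      (fun a b => mul_nonneg (by norm_num) (WW_nonneg _ _))
      (fun a => by cases a <;> norm_num)
      (fun a => by cases a <;> norm_num [WW])
      (by norm_num) hb
  refine this.trans ?_
  have hs : Summable (fun t : ℕ => ((t : ℝ) + 1) ^ 2 * (0.9995 : ℝ) ^ t) := by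
    have h2 := summable_pow_mul_geometric_of_norm_lt_one (R := ℝ) 2 (r := 0.9995)
      (by norm_num)
    have h1 := summable_pow_mul_geometric_of_norm_lt_one (R := ℝ) 1 (r := 0.9995)
      (by norm_num)
    have h0 := summable_pow_mul_geometric_of_norm_lt_one (R := ℝ) 0 (r := 0.9995)
      (by norm_num)
    refine ((h2.add (h1.mul_left 2)).add h0).congr fun t => ?_
    ring
  have hle := hs.sum_le_tsum (Finset.range (m + 1)) (fun t _ => by positivity)
  have hS : (∑ a : Bool, (if a then (1:ℝ) else 11.136)) = 12.136 := by norm_num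
  rw [hS]
  exact mul_le_mul_of_nonneg_right hle (by positivity)

lemma unsat_bound {n : ℕ} (hn : 10000 ≤ n) :
    unifProb (fun A : Fin (⌊(5.06 : ℝ) * n⌋₊) → Fin 5 → Clause n 3 =>
          ¬ Satisfiable (fun i => select (by norm_num) (A i))) ≤
      (∑' t : ℕ, ((t : ℝ) + 1) ^ 2 * (0.9995 : ℝ) ^ t) * (12.136 / n) :=
  (transfer_bound n _).trans
    (wt_bound (lt_of_lt_of_le (by norm_num) hn) (le_trans (by norm_num) hn) (pc_bound hn))

lemma unifProb_not {α : Type*} [Fintype α] [Nonempty α] (P : α → Prop) :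
    unifProb P = 1 - unifProb (fun a => ¬ P a) := by
  classical
  unfold unifProb
  have h := Fintype.card_subtype_compl P
  have hle := Fintype.card_subtype_le P
  rw [Nat.card_eq_fintype_card, Nat.card_eq_fintype_card, h, Nat.cast_sub hle]
  have : (Fintype.card α : ℝ) ≠ 0 := by
    exact_mod_cast Fintype.card_ne_zero
  field_simp
  ring

/-- The 5-clause Achlioptas rule `select` for random 3-SAT (select the first among the first
4 presented clauses with at least two positive literals, otherwise the 5th) generates a
formula that is satisfiable whp after `⌊5.06 * n⌋` steps. -/
theorem achlioptas_3sat_delay :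
    Tendsto (fun n : ℕ =>
        unifProb (fun A : Fin (⌊(5.06 : ℝ) * n⌋₊) → Fin 5 → Clause n 3 =>
          Satisfiable (fun i => select (by norm_num) (A i))))
      atTop (nhds 1) := by
  set K := ∑' t : ℕ, ((t : ℝ) + 1) ^ 2 * (0.9995 : ℝ) ^ t
  have hlim : Tendsto (fun n : ℕ => 1 - K * (12.136 / (n : ℝ))) atTop (nhds 1) := by
    have h := (tendsto_const_div_atTop_nhds_zero_nat (12.136 : ℝ)).const_mul K
    have := h.const_sub 1
    simpa using this
  refine tendsto_of_tendsto_of_tendsto_of_le_of_le' hlim tendsto_const_nhds ?_ ?_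
  · filter_upwards [eventually_ge_atTop 10000] with n hn
    have hne : Nonempty (Clause n 3) := by
      have hN := card_clause (n := n)
      have : 0 < n.choose 3 := Nat.choose_pos (by omega)
      exact Fintype.card_pos_iff.1 (by omega)
    rw [unifProb_not]
    exact sub_le_sub_left (unsat_bound hn) 1
  · filter_upwards with n
    unfold unifProb
    refine div_le_one_of_le₀ ?_ (by positivity)
    rw [← Nat.card_eq_fintype_card]
    exact_mod_cast Finite.card_subtype_le _
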